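/- Let (Ω,𝒜,ℙ) be a probability space and Z : Ω × D → ℝ a jointly measurable stochastic process such that x ↦ Z(ω,x) is continuous for every ω ∈ Ω, with continuous covariance kernel k(x,y) = E[Z_x Z_y], E[Z_x] = 0 for every x, and which is a centred Gaussian process: for every finite tuple of points in D and real coefficients, the corresponding linear combination of the Z_{x^(i)} has a (possibly degenerate) centred Gaussian distribution. Then for any u, v ⊆ I with u ≠ v the following are equivalent: (i) k_{u,v}(x,y) = 0 for all x, y ∈ D; (ii) the random functions ω ↦ (Z^{(u)}(ω,x))_{x∈D} and ω ↦ (Z^{(v)}(ω,x))_{x∈D}, regarded as random elements of ℝ^D equipped with the σ-algebra generated by the evaluation maps, are independent. -/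

import Mathlib

open MeasureTheory Finset ProbabilityTheory

/-- Substitute the coordinates in `u` from `x`, the remaining coordinates from `z`. -/
def combine {d : ℕ} (D : Fin d → Set ℝ) (u : Finset (Fin d)) (x z : ∀ i, D i) : ∀ i, D i :=
  fun j => if j ∈ u then x j else z j

/-- FANOVA projection `T_u f (x) = ∑_{u'⊆u} (−1)^{|u|−|u'|} ∫ f(x) ν_{−u'}(dx_{−u'})`. -/
noncomputable def Tproj {d : ℕ} (D : Fin d → Set ℝ) (ν : ∀ i, Measure (D i))
    (u : Finset (Fin d)) (f : (∀ i, D i) → ℝ) : (∀ i, D i) → ℝ :=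
  fun x => ∑ u' ∈ u.powerset, (-1 : ℝ) ^ (u.card - u'.card) *
    ∫ z, f (combine D u' x z) ∂(Measure.pi ν)

/-- KANOVA term `k_{u,v}` of a kernel `k`. -/
noncomputable def kanova {d : ℕ} (D : Fin d → Set ℝ) (ν : ∀ i, Measure (D i))
    (u v : Finset (Fin d)) (k : (∀ i, D i) → (∀ i, D i) → ℝ) :
    (∀ i, D i) → (∀ i, D i) → ℝ :=
  fun x y => ∑ u' ∈ u.powerset, ∑ v' ∈ v.powerset,
    (-1 : ℝ) ^ (u.card + v.card - u'.card - v'.card) *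
    ∫ z, (∫ w, k (combine D u' x z) (combine D v' y w) ∂(Measure.pi ν)) ∂(Measure.pi ν)

open Filter Topology

section GaussianLimits

variable {Ω : Type*} [MeasurableSpace Ω] {P : Measure Ω}

/-- A pointwise limit of centred Gaussian random variables is a centred Gaussian variable. -/
theorem exists_map_eq_gaussianReal_of_tendsto [IsProbabilityMeasure P]
    {Y : ℕ → Ω → ℝ} {X : Ω → ℝ}
    (hY : ∀ n, AEMeasurable (Y n) P)
    (hgauss : ∀ n, ∃ w : NNReal, P.map (Y n) = gaussianReal 0 w)
    (hlim : ∀ ω, Tendsto (fun n => Y n ω) atTop (𝓝 (X ω))) :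
    ∃ w : NNReal, P.map X = gaussianReal 0 w := by
  choose w hw using hgauss
  have hX : AEMeasurable X P :=
    aemeasurable_of_tendsto_metrizable_ae atTop hY (ae_of_all _ hlim)
  have : IsProbabilityMeasure (P.map X) := Measure.isProbabilityMeasure_map hX
  have hchar (t : ℝ) : Tendsto (fun n => (Real.exp (-(w n * t ^ 2 / 2)) : ℂ)) atTop
      (𝓝 (charFun (P.map X) t)) := by
    have h₁ (n : ℕ) : (Real.exp (-(w n * t ^ 2 / 2)) : ℂ)
        = ∫ ω, Complex.exp (t * Y n ω * Complex.I) ∂P := by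
      rw [← integral_map (f := fun x : ℝ => Complex.exp (t * x * Complex.I)) (hY n)
        (by fun_prop), ← charFun_apply_real, hw n, charFun_gaussianReal]
      push_cast
      congr 1
      ring
    simp_rw [h₁]
    rw [charFun_apply_real, integral_map hX (by fun_prop)]
    refine tendsto_integral_of_dominated_convergence (fun _ => 1) (fun n => ?_)
      (integrable_const _) (fun n => ae_of_all _ fun ω => ?_) (ae_of_all _ fun ω => ?_)
    · have := hY n
      exact AEMeasurable.aestronglyMeasurable (by fun_prop)
    · rw [← Complex.ofReal_mul, Complex.norm_exp_ofReal_mul_I]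
    · have hc : Continuous fun x : ℝ => Complex.exp (t * x * Complex.I) := by fun_prop
      exact (hc.tendsto _).comp (hlim ω)
  have hreal (t : ℝ) : Tendsto (fun n => Real.exp (-(w n * t ^ 2 / 2))) atTop
      (𝓝 (charFun (P.map X) t).re) := by
    simpa only [Function.comp_def, Complex.ofReal_re] using
      (Complex.continuous_re.tendsto _).comp (hchar t)
  obtain ⟨t, ht, hpos⟩ : ∃ t : ℝ, 0 < t ∧ 0 < (charFun (P.map X) t).re := by
    have hc : Continuous fun t : ℝ => (charFun (P.map X) t).re :=
      Complex.continuous_re.comp continuous_charFun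
    have h0 : ∀ᶠ t in 𝓝 (0 : ℝ), 0 < (charFun (P.map X) t).re :=
      hc.continuousAt.eventually (lt_mem_nhds (by simp))
    have h1 : ∀ᶠ t in 𝓝[>] (0 : ℝ), 0 < (charFun (P.map X) t).re :=
      h0.filter_mono nhdsWithin_le_nhds
    have h2 : ∀ᶠ t in 𝓝[>] (0 : ℝ), 0 < t := self_mem_nhdsWithin
    exact (h2.and h1).exists
  obtain ⟨v, hv⟩ : ∃ v : ℝ, Tendsto (fun n => (w n : ℝ)) atTop (𝓝 v) := by
    have := ((hreal t).log hpos.ne').const_mul (-(2 / t ^ 2))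
    refine ⟨_, this.congr fun n => ?_⟩
    rw [Real.log_exp]
    field_simp
  lift v to NNReal using ge_of_tendsto' hv fun n => (w n).2
  refine ⟨v, Measure.ext_of_charFun ?_⟩
  ext s
  refine tendsto_nhds_unique (hchar s) ?_
  have hlim' : Tendsto (fun n => Real.exp (-(w n * s ^ 2 / 2))) atTop
      (𝓝 (Real.exp (-(v * s ^ 2 / 2)))) :=
    (Real.continuous_exp.tendsto _).comp (((hv.mul_const _).div_const _).neg)
  have := (Complex.continuous_ofReal.tendsto _).comp hlim'
  have heq : charFun (gaussianReal 0 v) s = (Real.exp (-(v * s ^ 2 / 2)) : ℂ) := by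
    rw [charFun_gaussianReal]
    push_cast
    congr 1
    ring
  rw [heq]
  exact this

/-- A real process whose finite linear combinations are all centred Gaussian is Gaussian. -/
theorem isGaussianProcess_of_map_sum_eq_gaussianReal {T : Type*} {X : T → Ω → ℝ}
    (hX : ∀ t, AEMeasurable (X t) P)
    (h : ∀ (s : Finset T) (c : s → ℝ), ∃ w : NNReal,
      P.map (fun ω => ∑ t : s, c t * X t ω) = gaussianReal 0 w) :
    IsGaussianProcess X P where
  hasGaussianLaw s := by
    classical
    refine ⟨isGaussian_of_map_eq_gaussianReal fun L => ?_⟩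
    obtain ⟨w, hw⟩ := h s fun t => L (Pi.single t 1)
    refine ⟨0, w, ?_⟩
    have hXs : AEMeasurable (fun ω => s.restrict fun t => X t ω) P :=
      aemeasurable_pi_lambda _ fun t => hX t
    rw [← hw, AEMeasurable.map_map_of_aemeasurable (by fun_prop) hXs]
    congr 1
    ext ω
    rw [Function.comp_apply, ← L.sum_comp_single]
    refine Finset.sum_congr rfl fun t _ => ?_
    have : (Pi.single t (X t ω) : s → ℝ) = X t ω • Pi.single t 1 := by
      rw [← Pi.single_smul, smul_eq_mul, mul_one]
    simp [this, mul_comm]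

theorem memLp_two_of_map_eq_gaussianReal {X : Ω → ℝ} {m : ℝ} {w : NNReal}
    (hX : AEMeasurable X P) (h : P.map X = gaussianReal m w) : MemLp X 2 P := by
  have := memLp_id_gaussianReal (μ := m) (v := w) 2
  rw [← h] at this
  exact (memLp_map_measure_iff (by fun_prop) hX).1 this

theorem integral_eq_of_map_eq_gaussianReal {X : Ω → ℝ} {m : ℝ} {w : NNReal}
    (hX : AEMeasurable X P) (h : P.map X = gaussianReal m w) : ∫ ω, X ω ∂P = m := by
  rw [← integral_map (f := fun x : ℝ => x) hX (by fun_prop), h, integral_id_gaussianReal]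

end GaussianLimits

theorem integral_comp_simpleFunc {α β : Type*} [MeasurableSpace α] (μ : Measure α)
    [IsFiniteMeasure μ] (s : SimpleFunc α β) (g : β → ℝ) :
    ∫ z, g (s z) ∂μ = ∑ e ∈ s.range, μ.real (s ⁻¹' {e}) * g e := by
  classical
  have h (z : α) : g (s z) = ∑ e ∈ s.range, (s ⁻¹' {e}).indicator (fun _ => g e) z := by
    rw [Finset.sum_eq_single_of_mem (s z) (s.mem_range_self z)]
    · simp
    · intro e _ he
      exact Set.indicator_of_notMem (fun hz => he hz.symm) _
  simp_rw [h]
  rw [integral_finsetSum _ fun e _ =>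
    (integrable_const _).indicator (s.measurableSet_preimage _)]
  refine Finset.sum_congr rfl fun e _ => ?_
  rw [integral_indicator_const _ (s.measurableSet_preimage _), smul_eq_mul]

theorem exists_map_fintype_sum_eq_gaussianReal {Ω E : Type*} [MeasurableSpace Ω] {P : Measure Ω}
    {Z : Ω → E → ℝ}
    (hgauss : ∀ (n : ℕ) (x : Fin n → E) (c : Fin n → ℝ), ∃ w : NNReal,
      P.map (fun ω => ∑ i : Fin n, c i * Z ω (x i)) = gaussianReal 0 w)
    {ι : Type*} [Fintype ι] (x : ι → E) (c : ι → ℝ) : ∃ w : NNReal,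
      P.map (fun ω => ∑ i, c i * Z ω (x i)) = gaussianReal 0 w := by
  let e := (Fintype.equivFin ι).symm
  obtain ⟨w, hw⟩ := hgauss (Fintype.card ι) (x ∘ e) (c ∘ e)
  refine ⟨w, ?_⟩
  rw [← hw]
  congr 1
  ext ω
  exact (Equiv.sum_comp e fun i => c i * Z ω (x i)).symm

section IntegratedProcess

variable {Ω : Type*} [MeasurableSpace Ω] {P : Measure Ω} [IsProbabilityMeasure P]
  {E : Type*} [PseudoMetricSpace E] [CompactSpace E] [MeasurableSpace E] [BorelSpace E]
  {μ : Measure E} [IsProbabilityMeasure μ] {Z : Ω → E → ℝ}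

theorem measurable_integral_comp (hmeas : Measurable fun p : Ω × E => Z p.1 p.2)
    {φ : E → E} (hφ : Continuous φ) : Measurable fun ω => ∫ z, Z ω (φ z) ∂μ := by
  have : Measurable fun p : Ω × E => Z p.1 (φ p.2) :=
    hmeas.comp (measurable_fst.prodMk (hφ.measurable.comp measurable_snd))
  exact this.stronglyMeasurable.integral_prod_right.measurable

/-- Linear combinations of integrals of a centred Gaussian process with continuous paths over a
compact space are centred Gaussian. -/
theorem exists_map_sum_integral_eq_gaussianReal
    (hmeas : Measurable fun p : Ω × E => Z p.1 p.2) (hcont : ∀ ω, Continuous (Z ω))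
    (hgauss : ∀ (n : ℕ) (x : Fin n → E) (c : Fin n → ℝ), ∃ w : NNReal,
      P.map (fun ω => ∑ i : Fin n, c i * Z ω (x i)) = gaussianReal 0 w)
    {ι : Type*} [Fintype ι] {φ : ι → E → E} (hφ : ∀ i, Continuous (φ i)) (c : ι → ℝ) :
    ∃ w : NNReal, P.map (fun ω => ∑ i, c i * ∫ z, Z ω (φ i z) ∂μ) = gaussianReal 0 w := by
  obtain ⟨e₀⟩ : Nonempty E := μ.nonempty_of_neZero
  let s (n : ℕ) : SimpleFunc E E :=
    SimpleFunc.approxOn id measurable_id Set.univ e₀ (Set.mem_univ _) n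
  have hs (z : E) : Tendsto (fun n => s n z) atTop (𝓝 z) :=
    SimpleFunc.tendsto_approxOn measurable_id (Set.mem_univ e₀) (by simp)
  have hsum (n : ℕ) : (fun ω => ∑ i, c i * ∫ z, Z ω (φ i (s n z)) ∂μ) = fun ω =>
      ∑ p : ι × (s n).range, c p.1 * μ.real (s n ⁻¹' {p.2.1}) * Z ω (φ p.1 p.2.1) := by
    ext ω
    rw [Fintype.sum_prod_type]
    refine Finset.sum_congr rfl fun i _ => ?_
    rw [integral_comp_simpleFunc μ (s n) (fun e => Z ω (φ i e)), Finset.mul_sum,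
      ← Finset.sum_coe_sort]
    simp only [mul_assoc]
  refine exists_map_eq_gaussianReal_of_tendsto
    (Y := fun n ω => ∑ i, c i * ∫ z, Z ω (φ i (s n z)) ∂μ) (fun n => ?_) (fun n => ?_)
    (fun ω => ?_)
  · rw [hsum n]
    refine Measurable.aemeasurable (Finset.measurable_fun_sum _ fun p _ => ?_)
    exact (hmeas.comp (measurable_id.prodMk measurable_const)).const_mul _
  · rw [hsum n]
    exact exists_map_fintype_sum_eq_gaussianReal hgauss
      (fun p : ι × (s n).range => φ p.1 p.2.1) _
  · refine tendsto_finsetSum _ fun i _ => Tendsto.const_mul _ ?_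
    obtain ⟨C, hC⟩ := isCompact_univ.exists_bound_of_continuousOn (hcont ω).continuousOn
    refine tendsto_integral_of_dominated_convergence (fun _ => C) (fun n => ?_)
      (integrable_const _) (fun n => ae_of_all _ fun z => hC _ (Set.mem_univ _))
      (ae_of_all _ fun z => ?_)
    · exact (((hcont ω).comp (hφ i)).measurable.comp (s n).measurable).aestronglyMeasurable
    · exact (((hcont ω).comp (hφ i)).tendsto z).comp (hs z)

/-- The second moments of integrals of a process with continuous covariance kernel are integrals
of the kernel. -/
theorem integral_mul_integral_comp_eq
    (hmeas : Measurable fun p : Ω × E => Z p.1 p.2)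
    (hL2 : ∀ x, MemLp (fun ω => Z ω x) 2 P)
    {k : E → E → ℝ} (hk : ∀ x y, k x y = ∫ ω, Z ω x * Z ω y ∂P)
    (hk_cont : Continuous fun p : E × E => k p.1 p.2)
    {φ ψ : E → E} (hφ : Continuous φ) (hψ : Continuous ψ) :
    ∫ ω, (∫ z, Z ω (φ z) ∂μ) * (∫ z, Z ω (ψ z) ∂μ) ∂P
      = ∫ z, ∫ z', k (φ z) (ψ z') ∂μ ∂μ := by
  have hmem {χ : E × E → E} (hχ : Continuous χ) :
      MemLp (fun p : Ω × (E × E) => Z p.1 (χ p.2)) 2 (P.prod (μ.prod μ)) := by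
    have hm : Measurable fun p : Ω × (E × E) => Z p.1 (χ p.2) :=
      hmeas.comp (measurable_fst.prodMk (hχ.measurable.comp measurable_snd))
    rw [memLp_two_iff_integrable_sq hm.aestronglyMeasurable,
      integrable_prod_iff' (hm.pow_const 2).aestronglyMeasurable]
    refine ⟨ae_of_all _ fun q => (hL2 (χ q)).integrable_sq, ?_⟩
    have hc : Continuous fun q : E × E => k (χ q) (χ q) := hk_cont.comp (hχ.prodMk hχ)
    refine (hc.integrable_of_hasCompactSupport (HasCompactSupport.of_compactSpace _)).congr
      (ae_of_all _ fun q => ?_)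
    simp [hk, sq]
  have hint := (hmem (hφ.comp continuous_fst)).integrable_mul (hmem (hψ.comp continuous_snd))
  have hc : Continuous fun q : E × E => k (φ q.1) (ψ q.2) :=
    hk_cont.comp ((hφ.comp continuous_fst).prodMk (hψ.comp continuous_snd))
  calc ∫ ω, (∫ z, Z ω (φ z) ∂μ) * (∫ z, Z ω (ψ z) ∂μ) ∂P
      = ∫ ω, ∫ q : E × E, Z ω (φ q.1) * Z ω (ψ q.2) ∂(μ.prod μ) ∂P := by
        simp_rw [← integral_prod_mul]
    _ = ∫ q : E × E, ∫ ω, Z ω (φ q.1) * Z ω (ψ q.2) ∂P ∂(μ.prod μ) :=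
        integral_integral_swap hint
    _ = ∫ q : E × E, k (φ q.1) (ψ q.2) ∂(μ.prod μ) := by simp_rw [hk]
    _ = ∫ z, ∫ z', k (φ z) (ψ z') ∂μ ∂μ :=
        integral_prod _ (hc.integrable_of_hasCompactSupport (HasCompactSupport.of_compactSpace _))

end IntegratedProcess

section Fanova

variable {d : ℕ} {D : Fin d → Set ℝ} {ν : ∀ i, Measure (D i)}

/-- The coefficient of the `u'`-th integral in the FANOVA projection on `u`. -/
noncomputable def fanovaCoeff (u u' : Finset (Fin d)) : ℝ :=
  if u' ∈ u.powerset then (-1) ^ (u.card - u'.card) else 0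

theorem continuous_combine (u : Finset (Fin d)) (x : ∀ i, D i) :
    Continuous (combine D u x) := by
  refine continuous_pi fun j => ?_
  unfold combine
  split_ifs <;> fun_prop

theorem Tproj_eq_sum_fanovaCoeff (u : Finset (Fin d)) (f : (∀ i, D i) → ℝ) (x : ∀ i, D i) :
    Tproj D ν u f x
      = ∑ u', fanovaCoeff u u' * ∫ z, f (combine D u' x z) ∂(Measure.pi ν) := by
  simp only [Tproj, fanovaCoeff, ite_mul, zero_mul, Finset.sum_ite_mem, Finset.univ_inter]

theorem kanova_eq_sum_fanovaCoeff (u v : Finset (Fin d))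
    (k : (∀ i, D i) → (∀ i, D i) → ℝ) (x y : ∀ i, D i) :
    kanova D ν u v k x y = ∑ u', ∑ v', fanovaCoeff u u' * (fanovaCoeff v v' *
      ∫ z, ∫ w, k (combine D u' x z) (combine D v' y w) ∂(Measure.pi ν) ∂(Measure.pi ν)) := by
  simp only [kanova, fanovaCoeff, ite_mul, zero_mul, mul_ite, mul_zero, Finset.sum_ite_mem,
    Finset.univ_inter, Finset.sum_ite_irrel, Finset.sum_const_zero]
  refine Finset.sum_congr rfl fun u' hu' => Finset.sum_congr rfl fun v' hv' => ?_
  have hu := Finset.card_le_card (Finset.mem_powerset.1 hu')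
  have hv := Finset.card_le_card (Finset.mem_powerset.1 hv')
  rw [← mul_assoc, ← pow_add]
  congr 2
  omega

end Fanova

/-- **Independence of FANOVA effects.**  For a jointly measurable, centred Gaussian
process `Z` with continuous sample paths and continuous covariance kernel
`k(x,y) = E[Z_x Z_y]`, and any `u ≠ v`, the cross KANOVA term `k_{u,v}` vanishes
identically if and only if the random functions `Z^{(u)}` and `Z^{(v)}`, regarded as
random elements of `ℝ^D` equipped with the σ-algebra generated by the evaluation maps
(the product σ-algebra), are independent. -/
theorem fanova_effects_independence {d : ℕ} (hd : 1 ≤ d)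
    (a b : Fin d → ℝ) (hab : ∀ i, a i < b i)
    (D : Fin d → Set ℝ) (hD : ∀ i, D i = Set.Icc (a i) (b i))
    (ν : ∀ i, Measure (D i)) [∀ i, IsProbabilityMeasure (ν i)]
    {Ω : Type*} [MeasurableSpace Ω] (P : Measure Ω) [IsProbabilityMeasure P]
    (Z : Ω → (∀ i, D i) → ℝ)
    (hZ_meas : Measurable (fun p : Ω × (∀ i, D i) => Z p.1 p.2))
    (hZ_cont : ∀ ω, Continuous (Z ω))
    (hZ_centred : ∀ x, ∫ ω, Z ω x ∂P = 0)
    (hZ_gauss : ∀ (n : ℕ) (x : Fin n → ∀ i, D i) (c : Fin n → ℝ),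
      ∃ w : NNReal,
        P.map (fun ω => ∑ i : Fin n, c i * Z ω (x i)) = gaussianReal 0 w)
    (k : (∀ i, D i) → (∀ i, D i) → ℝ)
    (hk : ∀ x y, k x y = ∫ ω, Z ω x * Z ω y ∂P)
    (hk_cont : Continuous (fun p : (∀ i, D i) × (∀ i, D i) => k p.1 p.2))
    (u v : Finset (Fin d)) (huv : u ≠ v) :
    (∀ x y : ∀ i, D i, kanova D ν u v k x y = 0) ↔
      IndepFun (fun ω => fun x => Tproj D ν u (Z ω) x)
        (fun ω => fun x => Tproj D ν v (Z ω) x) P := by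
  have (i : Fin d) : CompactSpace (D i) :=
    isCompact_iff_compactSpace.1 (hD i ▸ isCompact_Icc)
  let A (x : ∀ i, D i) (u' : Finset (Fin d)) (ω : Ω) : ℝ :=
    ∫ z, Z ω (combine D u' x z) ∂(Measure.pi ν)
  have hA_meas (x u') : AEMeasurable (A x u') P :=
    (measurable_integral_comp hZ_meas (continuous_combine u' x)).aemeasurable
  have hA_sum {ι : Type} [Fintype ι] (x : ι → ∀ i, D i) (s : ι → Finset (Fin d)) (c : ι → ℝ) :
      ∃ w : NNReal, P.map (fun ω => ∑ i, c i * A (x i) (s i) ω) = gaussianReal 0 w :=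
    exists_map_sum_integral_eq_gaussianReal hZ_meas hZ_cont hZ_gauss
      (fun i => continuous_combine (s i) (x i)) c
  have hA_gauss (x u') : ∃ w : NNReal, P.map (A x u') = gaussianReal 0 w := by
    simpa using hA_sum (fun _ : Unit => x) (fun _ => u') fun _ => 1
  have hA_L2 (x u') : MemLp (A x u') 2 P :=
    memLp_two_of_map_eq_gaussianReal (hA_meas x u') (hA_gauss x u').choose_spec
  have hA_mean (x u') : ∫ ω, A x u' ω ∂P = 0 :=
    integral_eq_of_map_eq_gaussianReal (hA_meas x u') (hA_gauss x u').choose_spec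
  have hZ_L2 (x) : MemLp (fun ω => Z ω x) 2 P := by
    obtain ⟨w, hw⟩ := hZ_gauss 1 (fun _ => x) fun _ => 1
    refine memLp_two_of_map_eq_gaussianReal (m := 0) (w := w) ?_ (by simpa using hw)
    exact (hZ_meas.comp (measurable_id.prodMk measurable_const)).aemeasurable
  have hA_cov (x y u' v') : cov[A x u', A y v'; P] = ∫ z, ∫ w,
      k (combine D u' x z) (combine D v' y w) ∂(Measure.pi ν) ∂(Measure.pi ν) := by
    rw [covariance_eq_sub (hA_L2 x u') (hA_L2 y v'), hA_mean, zero_mul, sub_zero]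
    exact integral_mul_integral_comp_eq hZ_meas hZ_L2 hk hk_cont (continuous_combine u' x)
      (continuous_combine v' y)
  let X (u : Finset (Fin d)) (x : ∀ i, D i) (ω : Ω) : ℝ := Tproj D ν u (Z ω) x
  have hX (u x) : X u x = fun ω => ∑ u', fanovaCoeff u u' * A x u' ω :=
    funext fun ω => Tproj_eq_sum_fanovaCoeff u (Z ω) x
  have hX_meas (u x) : AEMeasurable (X u x) P := by
    rw [hX]
    exact Finset.aemeasurable_fun_sum _ fun u' _ => (hA_meas x u').const_mul _
  have hX_L2 (u x) : MemLp (X u x) 2 P := by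
    rw [hX]
    exact memLp_finsetSum _ fun u' _ => (hA_L2 x u').const_mul _
  have hX_cov (x y) : cov[X u x, X v y; P] = kanova D ν u v k x y := by
    rw [hX, hX, covariance_fun_sum_fun_sum (fun u' => (hA_L2 x u').const_mul _)
      (fun v' => (hA_L2 y v').const_mul _), kanova_eq_sum_fanovaCoeff]
    simp only [covariance_const_mul_left, covariance_const_mul_right, hA_cov, mul_left_comm]
  refine ⟨fun h => ?_, fun h x y => ?_⟩
  · refine IsGaussianProcess.indepFun_of_covariance_eq_zero (X := X u) (Y := X v) ?_
      (hX_meas u) (hX_meas v) fun x y => (hX_cov x y).trans (h x y)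
    have hpoint (t : (∀ i, D i) ⊕ (∀ i, D i)) : Sum.elim (X u) (X v) t
        = X (Sum.elim (fun _ => u) (fun _ => v) t) (Sum.elim id id t) := by
      cases t <;> rfl
    refine isGaussianProcess_of_map_sum_eq_gaussianReal (fun t => hpoint t ▸ hX_meas _ _)
      fun s c => ?_
    obtain ⟨w, hw⟩ := hA_sum (ι := s × Finset (Fin d)) (fun p => Sum.elim id id p.1.1)
      (fun p => p.2) fun p => c p.1 * fanovaCoeff (Sum.elim (fun _ => u) (fun _ => v) p.1.1) p.2
    refine ⟨w, ?_⟩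
    rw [← hw]
    congr 1
    ext ω
    rw [Fintype.sum_prod_type]
    refine Finset.sum_congr rfl fun t _ => ?_
    rw [hpoint, hX, Finset.mul_sum]
    simp only [mul_assoc]
  · rw [← hX_cov]
    exact (h.comp (measurable_pi_apply x) (measurable_pi_apply y)).covariance_eq_zero
      (hX_L2 u x) (hX_L2 v y)
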